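/- Fix y > 0 and define G(x, y) = Re( ∫_0^1 i·y²·( (1 − t²)((x + i t y)² − 1) )^{1/2} dt ) for x > 1, with the principal complex square root w^{1/2} = exp((1/2)·Log w). Then for every x > 1, the function t ↦ G(t, y) has derivative at t = x equal to −y²·∫_0^1 √(1 − t²)·Im( (x + i t y) / ((x + i t y)² − 1)^{1/2} ) dt, and this derivative is strictly positive. -/

import Mathlib

open Complex in
theorem sq_sub_one_mem_slitPlane {s b : ℝ} (hs : 1 < s) :
    ((s : ℂ) + b * I) ^ 2 - 1 ∈ slitPlane := by
  have hre : (((s : ℂ) + b * I) ^ 2 - 1).re = s ^ 2 - b ^ 2 - 1 := by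
    simp [pow_two]
  have him : (((s : ℂ) + b * I) ^ 2 - 1).im = 2 * s * b := by
    simp [pow_two]; ring
  rw [mem_slitPlane_iff, hre, him]
  rcases eq_or_ne b 0 with rfl | hb
  · left; nlinarith
  · right; positivity

open Complex in
theorem exp_half_log_sq {w : ℂ} (hw : w ≠ 0) : exp ((1 / 2) * log w) ^ 2 = w := by
  rw [← Complex.exp_nat_mul]
  conv_rhs => rw [← Complex.exp_log hw]
  congr 1
  push_cast
  ring

open Complex in
theorem exp_half_log_re_pos {w : ℂ} (hw : w ∈ slitPlane) : 0 < (exp ((1 / 2) * log w)).re := by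
  have him : ((1 / 2) * log w).im = w.arg / 2 := by
    have : ((1 / 2) * log w) = ((1 / 2 : ℝ) : ℂ) * log w := by push_cast; rfl
    rw [this, im_ofReal_mul, log_im]
    ring
  rw [exp_re, him]
  have h1 := neg_pi_lt_arg w
  have h2 := (arg_le_pi w).lt_of_ne (mem_slitPlane_iff_arg.1 hw).1
  exact mul_pos (Real.exp_pos _) (Real.cos_pos_of_mem_Ioo ⟨by linarith, by linarith⟩)

open Complex in
theorem exp_half_log_ofReal_mul {c : ℝ} (hc : 0 < c) {w : ℂ} (hw : w ≠ 0) :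
    exp ((1 / 2) * log (c * w)) = Real.sqrt c * exp ((1 / 2) * log w) := by
  rw [log_ofReal_mul hc hw, mul_add, Complex.exp_add]
  congr 1
  rw [Real.sqrt_eq_rpow, Real.rpow_def_of_pos hc]
  push_cast
  rw [mul_comm]

open Complex in
theorem im_div_exp_half_log_neg {s b : ℝ} (hs : 1 < s) (hb : 0 < b) :
    (((s : ℂ) + b * I) / exp ((1 / 2) * log (((s : ℂ) + b * I) ^ 2 - 1))).im < 0 := by
  have hw := sq_sub_one_mem_slitPlane (b := b) hs
  have hu := exp_half_log_re_pos hw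
  have hr := exp_half_log_sq (slitPlane_ne_zero hw)
  have hn := Complex.normSq_pos.2 (Complex.exp_ne_zero ((1 / 2) * log (((s : ℂ) + b * I) ^ 2 - 1)))
  generalize exp ((1 / 2) * log (((s : ℂ) + b * I) ^ 2 - 1)) = r at *
  obtain ⟨u, v⟩ := r
  have h1 := congrArg re hr
  have h2 := congrArg im hr
  simp [pow_two] at h1 h2 hu
  have huv : u * v = s * b := by linarith
  have hv : 0 < v := by
    have : 0 < u * v := by rw [huv]; positivity
    exact (mul_pos_iff_of_pos_left hu).1 this
  have key : b * u < s * v := by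
    by_contra! h
    have hus : s ≤ u := by
      have : b * s ^ 2 ≤ b * u ^ 2 := by nlinarith
      exact le_of_sq_le_sq (le_of_mul_le_mul_left this hb) hu.le
    have hvb : v ≤ b := by
      by_contra! h'
      nlinarith
    nlinarith
  rw [div_im, ← sub_div]
  apply div_neg_of_neg_of_pos _ hn
  simp
  linarith

open Complex in
theorem hasDerivAt_exp_half_log {s b : ℝ} (hs : 1 < s) :
    HasDerivAt (fun s : ℝ => exp ((1 / 2) * log (((s : ℂ) + b * I) ^ 2 - 1)))
      (((s : ℂ) + b * I) / exp ((1 / 2) * log (((s : ℂ) + b * I) ^ 2 - 1))) s := by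
  have hw := sq_sub_one_mem_slitPlane (b := b) hs
  have hr := exp_half_log_sq (slitPlane_ne_zero hw)
  have h0 : HasDerivAt (fun s : ℝ => ((s : ℂ) + b * I) ^ 2 - 1) (2 * ((s : ℂ) + b * I)) s := by
    simpa using (((hasDerivAt_id s).ofReal_comp.add_const (b * I : ℂ)).pow 2).sub_const 1
  have h := ((h0.clog_real hw).const_mul (1 / 2 : ℂ)).cexp
  refine h.congr_deriv ?_
  have hn := Complex.exp_ne_zero ((1 / 2) * log (((s : ℂ) + b * I) ^ 2 - 1))
  generalize exp ((1 / 2) * log (((s : ℂ) + b * I) ^ 2 - 1)) = r at hr hn ⊢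
  rw [← hr]
  field_simp

open Complex in
theorem continuousOn_exp_half_log (y : ℝ) :
    ContinuousOn (fun p : ℝ × ℝ => exp ((1 / 2) * log (((p.1 : ℂ) + p.2 * y * I) ^ 2 - 1)))
      {p | 1 < p.1} := by
  refine (ContinuousOn.clog (by fun_prop) ?_).const_smul (1 / 2 : ℂ) |>.cexp
  intro p hp
  simpa using sq_sub_one_mem_slitPlane (b := p.2 * y) hp


open Complex in
/-- For fixed `y > 0` and `x > 1`, the function
`s ↦ G(s,y) = Re ∫_0^1 i y² ((1−t²)((s+ity)²−1))^{1/2} dt` (principal square root)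
has derivative at `s = x` equal to
`−y²·∫_0^1 √(1−t²)·Im((x+ity)/((x+ity)²−1)^{1/2}) dt`, and this derivative is
strictly positive. -/
theorem stmt_17 (y : ℝ) (hy : 0 < y) (x : ℝ) (hx : 1 < x) :
    HasDerivAt
        (fun s : ℝ =>
          (∫ t in (0 : ℝ)..1, I * (y : ℂ) ^ 2 *
            Complex.exp ((1 / 2) *
              Complex.log ((1 - (t : ℂ) ^ 2) * (((s : ℂ) + t * y * I) ^ 2 - 1)))).re)
        (-y ^ 2 * ∫ t in (0 : ℝ)..1,
          Real.sqrt (1 - t ^ 2) *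
            (((x : ℂ) + t * y * I) /
              Complex.exp ((1 / 2) * Complex.log (((x : ℂ) + t * y * I) ^ 2 - 1))).im) x
      ∧ 0 < -y ^ 2 * ∫ t in (0 : ℝ)..1,
          Real.sqrt (1 - t ^ 2) *
            (((x : ℂ) + t * y * I) /
              Complex.exp ((1 / 2) * Complex.log (((x : ℂ) + t * y * I) ^ 2 - 1))).im := by
  have hdiv : ContinuousOn (fun p : ℝ × ℝ => ((p.1 : ℂ) + p.2 * y * I) /
      Complex.exp ((1 / 2) * Complex.log (((p.1 : ℂ) + p.2 * y * I) ^ 2 - 1))) {p | 1 < p.1} :=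
    ContinuousOn.div (by fun_prop) (continuousOn_exp_half_log y) fun _ _ => Complex.exp_ne_zero _
  let F : ℝ → ℝ → ℂ := fun s t => I * (y : ℂ) ^ 2 * ((Real.sqrt (1 - t ^ 2) : ℂ) *
    Complex.exp ((1 / 2) * Complex.log (((s : ℂ) + t * y * I) ^ 2 - 1)))
  let F' : ℝ → ℝ → ℂ := fun s t => I * (y : ℂ) ^ 2 * ((Real.sqrt (1 - t ^ 2) : ℂ) *
    (((s : ℂ) + t * y * I) /
      Complex.exp ((1 / 2) * Complex.log (((s : ℂ) + t * y * I) ^ 2 - 1))))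
  have hF : ContinuousOn (fun p : ℝ × ℝ => F p.1 p.2) {p | 1 < p.1} :=
    continuousOn_const.mul (ContinuousOn.mul (by fun_prop) (continuousOn_exp_half_log y))
  have hF' : ContinuousOn (fun p : ℝ × ℝ => F' p.1 p.2) {p | 1 < p.1} :=
    continuousOn_const.mul (ContinuousOn.mul (by fun_prop) hdiv)
  have slice {E : Type} [TopologicalSpace E] {g : ℝ × ℝ → E} (hg : ContinuousOn g {p | 1 < p.1})
      {s : ℝ} (hs : 1 < s) : Continuous fun t => g (s, t) :=
    hg.comp_continuous (by fun_prop) fun _ => hs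
  have hev : ∀ᶠ s in nhds x, 1 < s := lt_mem_nhds hx
  obtain ⟨M, hM⟩ : ∃ M, ∀ p ∈ Set.Icc ((1 + x) / 2) (x + 1) ×ˢ Set.Icc (0 : ℝ) 1,
      ‖F' p.1 p.2‖ ≤ M :=
    (isCompact_Icc.prod isCompact_Icc).exists_bound_of_continuousOn
      (hF'.mono fun p hp => show 1 < p.1 by linarith [hp.1.1])
  have hD := (intervalIntegral.hasDerivAt_integral_of_dominated_loc_of_deriv_le
    (μ := MeasureTheory.volume) (a := 0) (b := 1)
    (F := F) (F' := F') (x₀ := x) (bound := fun _ => M)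
    (Icc_mem_nhds (by linarith : (1 + x) / 2 < x) (by linarith : x < x + 1))
    (hev.mono fun s hs => (slice hF hs).aestronglyMeasurable)
    ((slice hF hx).intervalIntegrable 0 1)
    (slice hF' hx).aestronglyMeasurable
    (Filter.Eventually.of_forall fun t ht s hs =>
      hM (s, t) ⟨hs, Set.Ioc_subset_Icc_self (by simpa using ht)⟩)
    (continuous_const.intervalIntegrable 0 1)
    (Filter.Eventually.of_forall fun t _ s hs => by
      have h := hasDerivAt_exp_half_log (s := s) (b := t * y) (by linarith [hs.1])
      push_cast at h
      exact (h.const_mul _).const_mul _)).2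
  have hG : (fun s : ℝ => (∫ t in (0 : ℝ)..1, F s t).re) =ᶠ[nhds x] fun s : ℝ =>
      (∫ t in (0 : ℝ)..1, I * (y : ℂ) ^ 2 * Complex.exp ((1 / 2) *
        Complex.log ((1 - (t : ℂ) ^ 2) * (((s : ℂ) + t * y * I) ^ 2 - 1)))).re := by
    filter_upwards [hev] with s hs
    congr 1
    refine intervalIntegral.integral_congr_ae ?_
    filter_upwards [MeasureTheory.Measure.ae_ne MeasureTheory.volume (1 : ℝ)] with t ht1 ht
    rw [Set.uIoc_of_le zero_le_one] at ht
    have htl : t < 1 := ht.2.lt_of_ne ht1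
    have hw := sq_sub_one_mem_slitPlane (b := t * y) hs
    push_cast at hw
    have h := exp_half_log_ofReal_mul (c := 1 - t ^ 2) (by nlinarith [ht.1])
      (slitPlane_ne_zero hw)
    push_cast at h
    rw [h]
  have hre : (∫ t in (0 : ℝ)..1, F' x t).re = -y ^ 2 * ∫ t in (0 : ℝ)..1,
      Real.sqrt (1 - t ^ 2) * (((x : ℂ) + t * y * I) /
        Complex.exp ((1 / 2) * Complex.log (((x : ℂ) + t * y * I) ^ 2 - 1))).im := by
    rw [← intervalIntegral.integral_const_mul]
    refine (reCLM.intervalIntegral_comp_comm ((slice hF' hx).intervalIntegrable 0 1)).symm.trans ?_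
    refine intervalIntegral.integral_congr fun t _ => ?_
    change (I * (y : ℂ) ^ 2 * ((Real.sqrt (1 - t ^ 2) : ℂ) * _)).re = _
    rw [mul_assoc, I_mul_re, ← ofReal_pow, im_ofReal_mul, im_ofReal_mul]
    ring
  refine ⟨?_, ?_⟩
  · rw [← hre]
    exact (reCLM.hasFDerivAt.comp_hasDerivAt x hD).congr_of_eventuallyEq hG.symm
  · rw [← intervalIntegral.integral_const_mul]
    refine intervalIntegral.intervalIntegral_pos_of_pos_on
      (Continuous.intervalIntegrable ?_ 0 1) (fun t ht => ?_) zero_lt_one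
    · exact continuous_const.mul (Continuous.mul (by fun_prop) (continuous_im.comp (slice hdiv hx)))
    · have h := im_div_exp_half_log_neg hx (mul_pos ht.1 hy)
      push_cast at h
      have hs : 0 < Real.sqrt (1 - t ^ 2) := Real.sqrt_pos.2 (by nlinarith [ht.1, ht.2])
      nlinarith [mul_pos (pow_pos hy 2) (mul_pos hs (neg_pos.2 h))]
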